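/- arXiv:1602.06073 — 2 statements merged into one kernel-verified Lean document; each statement's English description precedes it below -/
import Mathlib

section
/- Let N > 0 and ε ≥ 0 be reals, and suppose γ : G → ℝ satisfies ∑_{g∈H} γ(g) = N and |γ(g)/N − 1/|H|| ≤ ε for every g ∈ H. Define the acceptance probability p(h) = 1 − (‖v₊(h)‖² / (4·Σγ²))² for h ∈ G. Then: (i) if h ∉ H, then p(h) = 3/4; (ii) if h ∈ H, then p(h) ≤ 2·ε²·|H|². -/
open scoped BigOperators Classical

/-- The vector `v₊(h) = ∑_{g∈H} γ(g)·(e_g + e_{g·h})` in `ℝ^G`. -/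
noncomputable def vplus {G : Type*} [Group G] [Fintype G] [DecidableEq G]
    (H : Subgroup G) (γ : G → ℝ) (h : G) : EuclideanSpace ℝ G :=
  ∑ g : H, γ (g : G) •
    (EuclideanSpace.single (g : G) (1 : ℝ) + EuclideanSpace.single ((g : G) * h) (1 : ℝ))

/-- The vector `v₋(h) = ∑_{g∈H} γ(g)·(e_g − e_{g·h})` in `ℝ^G`. -/
noncomputable def vminus {G : Type*} [Group G] [Fintype G] [DecidableEq G]
    (H : Subgroup G) (γ : G → ℝ) (h : G) : EuclideanSpace ℝ G :=
  ∑ g : H, γ (g : G) •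
    (EuclideanSpace.single (g : G) (1 : ℝ) - EuclideanSpace.single ((g : G) * h) (1 : ℝ))



theorem aux_coord {G : Type*} [Group G] [Fintype G] [DecidableEq G]
    (H : Subgroup G) (γ : G → ℝ) (h x : G) :
    vplus H γ h x = (if x ∈ H then γ x else 0) + (if x * h⁻¹ ∈ H then γ (x * h⁻¹) else 0) := by
  have key : ∀ y : G, (∑ g : H, if y = (g : G) then γ (g : G) else 0)
      = if y ∈ H then γ y else 0 := by
    intro y
    by_cases hy : y ∈ H
    · rw [Finset.sum_eq_single (⟨y, hy⟩ : H)]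
      · simp [hy]
      · intro b _ hb
        rw [if_neg]
        rintro rfl
        exact hb rfl
      · simp
    · rw [if_neg hy]
      apply Finset.sum_eq_zero
      intro g _
      rw [if_neg]
      rintro rfl
      exact hy g.2
  rw [← key x, ← key (x * h⁻¹), ← Finset.sum_add_distrib]
  simp only [vplus, WithLp.ofLp_sum, Finset.sum_apply]
  apply Finset.sum_congr rfl
  intro g _
  have e : (x = (g : G) * h) ↔ (x * h⁻¹ = (g : G)) := (mul_inv_eq_iff_eq_mul).symm
  simp [Pi.single_apply, mul_add, e]

theorem aux_sum {G : Type*} [Group G] [Fintype G] [DecidableEq G]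
    (H : Subgroup G) [DecidablePred (· ∈ H)] [Fintype H] (f : G → ℝ) :
    ∑ x : G, (if x ∈ H then f x else 0) = ∑ g : H, f g := by
  rw [← Finset.sum_filter]
  exact Finset.sum_subtype _ (by simp) _

/-- Under the near-uniformity hypotheses on `γ`, the acceptance
probability `p(h) = 1 − (‖v₊(h)‖²/(4·Σγ²))²` satisfies: (i) `p(h) = 3/4` if
`h ∉ H`; (ii) `p(h) ≤ 2·ε²·|H|²` if `h ∈ H`. -/
theorem acceptance_probability {G : Type*} [Group G] [Fintype G] [DecidableEq G]
    (H : Subgroup G) (γ : G → ℝ) (N ε : ℝ) (hN : 0 < N) (hε : 0 ≤ ε)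
    (hsum : ∑ g : H, γ (g : G) = N)
    (hnear : ∀ g : H, |γ (g : G) / N - 1 / (Nat.card H : ℝ)| ≤ ε)
    (h : G) :
    (h ∉ H → 1 - (‖vplus H γ h‖ ^ 2 / (4 * ∑ g : H, γ (g : G) ^ 2)) ^ 2 = 3 / 4) ∧
    (h ∈ H → 1 - (‖vplus H γ h‖ ^ 2 / (4 * ∑ g : H, γ (g : G) ^ 2)) ^ 2
      ≤ 2 * ε ^ 2 * (Nat.card H : ℝ) ^ 2) := by
  have hS1 : ∑ x : G, (if x ∈ H then γ x else 0) ^ 2 = ∑ g : H, γ (g : G) ^ 2 := by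
    rw [← aux_sum H (fun x => γ x ^ 2)]
    apply Finset.sum_congr rfl
    intro x _
    split_ifs <;> simp
  have hS2 : ∑ x : G, (if x * h⁻¹ ∈ H then γ (x * h⁻¹) else 0) ^ 2
      = ∑ g : H, γ (g : G) ^ 2 := by
    rw [← hS1]
    exact Equiv.sum_comp (Equiv.mulRight h⁻¹) (fun x => (if x ∈ H then γ x else 0) ^ 2)
  have hn : (0 : ℝ) < Nat.card H := by exact_mod_cast Nat.card_pos
  have hCS : N ^ 2 ≤ (Nat.card H : ℝ) * ∑ g : H, γ (g : G) ^ 2 := by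
    have := sq_sum_le_card_mul_sum_sq (s := (Finset.univ : Finset H)) (f := fun g => γ (g : G))
    rw [hsum, Finset.card_univ, ← Nat.card_eq_fintype_card] at this
    exact this
  have hnorm : ‖vplus H γ h‖ ^ 2 = ∑ x : G, ((if x ∈ H then γ x else 0)
      + (if x * h⁻¹ ∈ H then γ (x * h⁻¹) else 0)) ^ 2 := by
    rw [EuclideanSpace.real_norm_sq_eq]
    exact Finset.sum_congr rfl (fun x _ => by rw [aux_coord])
  rw [hnorm]
  have hSpos : 0 < ∑ g : H, γ (g : G) ^ 2 := by
    have : 0 < (Nat.card H : ℝ) * ∑ g : H, γ (g : G) ^ 2 := lt_of_lt_of_le (by positivity) hCS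
    exact (pos_iff_pos_of_mul_pos this).1 hn
  set S := ∑ g : H, γ (g : G) ^ 2 with hS
  set n : ℝ := (Nat.card H : ℝ) with hndef
  constructor
  · intro hh
    have : ∑ x : G, ((if x ∈ H then γ x else 0)
      + (if x * h⁻¹ ∈ H then γ (x * h⁻¹) else 0)) ^ 2 = 2 * S := by
      rw [two_mul]
      nth_rewrite 1 [← hS1]
      rw [← hS2, ← Finset.sum_add_distrib]
      apply Finset.sum_congr rfl
      intro x _
      by_cases h1 : x ∈ H
      · have h2 : x * h⁻¹ ∉ H := by
          rw [H.mul_mem_cancel_left h1, inv_mem_iff]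
          exact hh
        simp [h1, h2]
      · simp [h1]
    rw [this]
    field_simp
    norm_num
  · intro hh
    have hlow : 4 * S - n * (4 * ε ^ 2 * N ^ 2) ≤ ∑ x : G, ((if x ∈ H then γ x else 0)
      + (if x * h⁻¹ ∈ H then γ (x * h⁻¹) else 0)) ^ 2 := by
      have hc : n * (4 * ε ^ 2 * N ^ 2) = ∑ x : G, (if x ∈ H then 4 * ε ^ 2 * N ^ 2 else 0) := by
        rw [aux_sum H (fun _ => 4 * ε ^ 2 * N ^ 2), Finset.sum_const, Finset.card_univ,
          ← Nat.card_eq_fintype_card, nsmul_eq_mul]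
      have e4 : 4 * S = ∑ x : G, (2 * (if x ∈ H then γ x else 0) ^ 2
          + 2 * (if x * h⁻¹ ∈ H then γ (x * h⁻¹) else 0) ^ 2) := by
        rw [Finset.sum_add_distrib, ← Finset.mul_sum, ← Finset.mul_sum, hS1, hS2]
        ring
      rw [hc, e4, ← Finset.sum_sub_distrib]
      apply Finset.sum_le_sum
      intro x _
      by_cases h1 : x ∈ H
      · have h2 : x * h⁻¹ ∈ H := H.mul_mem h1 (H.inv_mem hh)
        simp only [h1, h2, if_true]
        have a1 := abs_le.1 (hnear ⟨x, h1⟩)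
        have a2 := abs_le.1 (hnear ⟨x * h⁻¹, h2⟩)
        simp only at a1 a2
        have a3 : |γ x / N - γ (x * h⁻¹) / N| ≤ 2 * ε := by
          rw [abs_le]
          constructor <;> linarith [a1.1, a1.2, a2.1, a2.2]
        rw [← sub_div, abs_div, abs_of_pos hN, div_le_iff₀ hN] at a3
        have a4 := pow_le_pow_left₀ (abs_nonneg _) a3 2
        rw [sq_abs] at a4
        nlinarith [a4]
      · have h2 : x * h⁻¹ ∉ H := by
          rwa [H.mul_mem_cancel_right (H.inv_mem hh)]
        simp [h1, h2]
    set T := ∑ x : G, ((if x ∈ H then γ x else 0)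
      + (if x * h⁻¹ ∈ H then γ (x * h⁻¹) else 0)) ^ 2
    have hr : 1 - n ^ 2 * ε ^ 2 ≤ T / (4 * S) := by
      rw [le_div_iff₀ (by positivity)]
      have : n * ε ^ 2 * N ^ 2 ≤ n * ε ^ 2 * (n * S) :=
        mul_le_mul_of_nonneg_left hCS (by positivity)
      nlinarith [this, hlow]
    nlinarith [sq_nonneg (T / (4 * S) - 1), hr]
end

section
/- If h ∈ H and the hypotheses of the previous setting hold (∑_{g∈H} γ(g) = N > 0 and |γ(g)/N − 1/|H|| ≤ ε for all g ∈ H), then 1 − (1 − ‖v₋(h)‖²/(4·Σγ²))² ≤ ‖v₋(h)‖²/(2·Σγ²) ≤ 2·ε²·|H|². -/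
open scoped BigOperators Classical

/-- If `h ∈ H` and `γ` satisfies the near-uniformity hypotheses,
then `1 − (1 − ‖v₋(h)‖²/(4·Σγ²))² ≤ ‖v₋(h)‖²/(2·Σγ²) ≤ 2·ε²·|H|²`. -/
theorem vminus_bound_of_mem {G : Type*} [Group G] [Fintype G] [DecidableEq G]
    (H : Subgroup G) (γ : G → ℝ) (N ε : ℝ) (hN : 0 < N) (hε : 0 ≤ ε)
    (hsum : ∑ g : H, γ (g : G) = N)
    (hnear : ∀ g : H, |γ (g : G) / N - 1 / (Nat.card H : ℝ)| ≤ ε)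
    (h : G) (hh : h ∈ H) :
    1 - (1 - ‖vminus H γ h‖ ^ 2 / (4 * ∑ g : H, γ (g : G) ^ 2)) ^ 2
      ≤ ‖vminus H γ h‖ ^ 2 / (2 * ∑ g : H, γ (g : G) ^ 2) ∧
    ‖vminus H γ h‖ ^ 2 / (2 * ∑ g : H, γ (g : G) ^ 2)
      ≤ 2 * ε ^ 2 * (Nat.card H : ℝ) ^ 2 := by
  have hv : vminus H γ h = ∑ g : H, (γ (g : G) - γ ((g * (⟨h, hh⟩ : H)⁻¹ : H) : G)) •
      EuclideanSpace.single (g : G) (1 : ℝ) := by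
    unfold vminus
    simp only [smul_sub, sub_smul, Finset.sum_sub_distrib]
    congr 1
    refine Fintype.sum_equiv (Equiv.mulRight (⟨h, hh⟩ : H)) _ _ ?_
    intro g
    simp
  have ho : Orthonormal ℝ (fun g : H => EuclideanSpace.single (g : G) (1 : ℝ)) :=
    (EuclideanSpace.orthonormal_single (𝕜 := ℝ) (ι := G)).comp _ Subtype.val_injective
  have hn : ‖vminus H γ h‖ ^ 2 =
      ∑ g : H, (γ (g : G) - γ ((g * (⟨h, hh⟩ : H)⁻¹ : H) : G)) ^ 2 := by
    rw [hv, ← real_inner_self_eq_norm_sq, ho.inner_sum]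
    simp [sq]
  have hc : (0 : ℝ) < Nat.card H := by exact_mod_cast Nat.card_pos
  have hcard : ((Finset.univ : Finset H).card : ℝ) = Nat.card H := by
    rw [Finset.card_univ, Nat.card_eq_fintype_card]
  have hb : ‖vminus H γ h‖ ^ 2 ≤ Nat.card H * (2 * ε * N) ^ 2 := by
    rw [hn, ← hcard, ← nsmul_eq_mul]
    refine Finset.sum_le_card_nsmul _ _ _ ?_
    intro g _
    have h1 := abs_le.1 (hnear g)
    have h2 := abs_le.1 (hnear (g * (⟨h, hh⟩ : H)⁻¹))
    have h3 : |γ (g : G) / N - γ ((g * (⟨h, hh⟩ : H)⁻¹ : H) : G) / N| ≤ 2 * ε := by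
      rw [abs_le]
      constructor <;> linarith [h1.1, h1.2, h2.1, h2.2]
    rw [← sub_div, abs_div, abs_of_pos hN, div_le_iff₀ hN] at h3
    exact sq_le_sq' (abs_le.1 h3 |>.1 |> fun t => by linarith) (abs_le.1 h3).2
  have hS : N ^ 2 ≤ Nat.card H * ∑ g : H, γ (g : G) ^ 2 := by
    rw [← hsum, ← hcard]
    exact sq_sum_le_card_mul_sum_sq
  have hSpos : 0 < ∑ g : H, γ (g : G) ^ 2 := by
    have : 0 < N ^ 2 := by positivity
    exact pos_of_mul_pos_right (this.trans_le hS) hc.le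
  generalize (∑ g : H, γ (g : G) ^ 2) = S at *
  generalize ‖vminus H γ h‖ ^ 2 = a at *
  constructor
  · have : a / (2 * S) = 2 * (a / (4 * S)) := by
      field_simp
      norm_num
    rw [this]
    nlinarith [sq_nonneg (a / (4 * S))]
  · rw [div_le_iff₀ (by positivity)]
    have := mul_le_mul_of_nonneg_left hS (show 0 ≤ 4 * ε ^ 2 * (Nat.card H : ℝ) by positivity)
    nlinarith
end
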